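/- arXiv:2112.01999 — 2 statements merged into one kernel-verified Lean document; each statement's English description precedes it below -/
import Mathlib

section
/- Let (Ω, 𝔉, P) be a probability space, X : Ω → ℝ a bounded random variable, and define Λ(θ) = log E_P[exp(θ X)] for θ ∈ ℝ. Then for every x ∈ ℝ, ε > 0 and λ, μ, μ̃ ≥ 0 one has P[ x < X < x + ε ] ≥ exp(−λ(x+ε) + Λ(λ)) · ( 1 − exp(−Λ(λ) + μ̃ x + Λ(λ − μ̃)) − exp(−Λ(λ) − μ(x+ε) + Λ(λ + μ)) ). -/
open MeasureTheory

/-- Pointwise form of the exponential tilting estimate: the tilted exponential, corrected by the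
two exponential Chebyshev bounds, is dominated by the indicator of the open interval. -/
lemma exp_tilt_sub_le_indicator_Ioo {a b l m n : ℝ} (hl : 0 ≤ l) (hm : 0 ≤ m) (hn : 0 ≤ n)
    (t : ℝ) :
    Real.exp (-l * b) * (Real.exp (l * t) - Real.exp (n * a) * Real.exp ((l - n) * t)
      - Real.exp (-m * b) * Real.exp ((l + m) * t)) ≤ (Set.Ioo a b).indicator 1 t := by
  simp only [← Real.exp_add]
  have hpos₁ := Real.exp_pos (n * a + (l - n) * t)
  have hpos₂ := Real.exp_pos (-m * b + (l + m) * t)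
  by_cases ht : t ∈ Set.Ioo a b
  · rw [Set.indicator_of_mem ht, Pi.one_apply]
    calc _ ≤ Real.exp (-l * b) * Real.exp (l * t) := by gcongr; linarith
      _ = Real.exp (-l * b + l * t) := (Real.exp_add _ _).symm
      _ ≤ 1 := Real.exp_le_one_iff.2 (by nlinarith [mul_le_mul_of_nonneg_left ht.2.le hl])
  · rw [Set.indicator_of_notMem ht]
    refine mul_nonpos_of_nonneg_of_nonpos (Real.exp_pos _).le ?_
    rcases le_or_gt t a with hta | hta
    · have : Real.exp (l * t) ≤ Real.exp (n * a + (l - n) * t) :=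
        Real.exp_le_exp.2 (by nlinarith [mul_le_mul_of_nonneg_left hta hn])
      linarith
    · have hbt : b ≤ t := not_lt.1 fun h => ht ⟨hta, h⟩
      have : Real.exp (l * t) ≤ Real.exp (-m * b + (l + m) * t) :=
        Real.exp_le_exp.2 (by nlinarith [mul_le_mul_of_nonneg_left hbt hm])
      linarith

/-- The exponential tilting estimate (equation (2.15) in the paper) underlying the lower
bound of Theorem 1(ii). -/
theorem stmt_2
    {Ω : Type*} [MeasurableSpace Ω]
    (P : Measure Ω) [IsProbabilityMeasure P]
    (X : Ω → ℝ) (hXmeas : Measurable X) (hXbdd : ∃ M : ℝ, ∀ ω, |X ω| ≤ M)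
    (Λ : ℝ → ℝ) (hΛ : ∀ θ : ℝ, Λ θ = Real.log (∫ ω, Real.exp (θ * X ω) ∂P))
    (x ε lam mu nu : ℝ) (hε : 0 < ε) (hlam : 0 ≤ lam) (hmu : 0 ≤ mu) (hmut : 0 ≤ nu) :
    (P {ω | x < X ω ∧ X ω < x + ε}).toReal ≥
      Real.exp (-lam * (x + ε) + Λ lam) *
        (1 - Real.exp (-Λ lam + nu * x + Λ (lam - nu))
           - Real.exp (-Λ lam - mu * (x + ε) + Λ (lam + mu))) := by
  obtain ⟨M, hM⟩ := hXbdd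
  have hint (θ : ℝ) : Integrable (fun ω => Real.exp (θ * X ω)) P :=
    ProbabilityTheory.integrable_exp_mul_of_mem_Icc hXmeas.aemeasurable
      (.of_forall fun ω => abs_le.1 (hM ω))
  have hexp (θ : ℝ) : Real.exp (Λ θ) = ∫ ω, Real.exp (θ * X ω) ∂P := by
    rw [hΛ]
    exact Real.exp_log (ProbabilityTheory.mgf_pos (hint θ))
  have hA : MeasurableSet (X ⁻¹' Set.Ioo x (x + ε)) := hXmeas measurableSet_Ioo
  calc Real.exp (-lam * (x + ε) + Λ lam) *
        (1 - Real.exp (-Λ lam + nu * x + Λ (lam - nu))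
           - Real.exp (-Λ lam - mu * (x + ε) + Λ (lam + mu)))
      = Real.exp (-lam * (x + ε)) * (Real.exp (Λ lam)
          - Real.exp (nu * x) * Real.exp (Λ (lam - nu))
          - Real.exp (-mu * (x + ε)) * Real.exp (Λ (lam + mu))) := by
        simp only [mul_sub, mul_one, ← Real.exp_add]
        ring_nf
    _ = ∫ ω, Real.exp (-lam * (x + ε)) * (Real.exp (lam * X ω)
          - Real.exp (nu * x) * Real.exp ((lam - nu) * X ω)
          - Real.exp (-mu * (x + ε)) * Real.exp ((lam + mu) * X ω)) ∂P := by
        rw [integral_const_mul, integral_sub (by exact (hint _).sub ((hint _).const_mul _))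
          ((hint _).const_mul _), integral_sub (hint _) ((hint _).const_mul _),
          integral_const_mul, integral_const_mul, hexp, hexp, hexp]
    _ ≤ ∫ ω, (X ⁻¹' Set.Ioo x (x + ε)).indicator 1 ω ∂P :=
        integral_mono
          ((((hint _).sub ((hint _).const_mul _)).sub ((hint _).const_mul _)).const_mul _)
          ((integrable_const (1 : ℝ)).indicator hA)
          fun ω => exp_tilt_sub_le_indicator_Ioo hlam hmu hmut (X ω)
    _ = (P {ω | x < X ω ∧ X ω < x + ε}).toReal := integral_indicator_one hA
end

section
/- Let H be a complex Hilbert space, C ≥ 0, and let f : ℝ → H be differentiable such that for every s ∈ ℝ there exist u(s), r(s) ∈ H with f'(s) = −i(u(s) + r(s)), ⟨f(s), u(s)⟩ ∈ ℝ, and ‖r(s)‖ ≤ C ‖f(s)‖. Then for all s, t ∈ ℝ one has ‖f(s)‖ ≤ e^{C |t − s|} ‖f(t)‖. -/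
open scoped InnerProductSpace

/-- One-sided differential Grönwall inequality. -/
lemma le_exp_mul_of_hasDerivAt_le {g g' : ℝ → ℝ} {K : ℝ} (hg : ∀ x, HasDerivAt g (g' x) x)
    (hle : ∀ x, g' x ≤ K * g x) {a b : ℝ} (hab : a ≤ b) :
    g b ≤ Real.exp (K * (b - a)) * g a := by
  have hderiv (x : ℝ) : HasDerivAt (fun y ↦ Real.exp (-K * y) * g y)
      (Real.exp (-K * x) * (g' x - K * g x)) x := by
    convert! ((hasDerivAt_id x).const_mul (-K)).exp.mul (hg x) using 1
    simp only [id]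
    ring
  have hanti : Antitone fun y ↦ Real.exp (-K * y) * g y :=
    antitone_of_hasDerivAt_nonpos hderiv fun x ↦
      mul_nonpos_of_nonneg_of_nonpos (Real.exp_pos _).le (sub_nonpos.2 (hle x))
  calc g b = Real.exp (K * b) * (Real.exp (-K * b) * g b) := by
        rw [← mul_assoc, ← Real.exp_add]; simp
    _ ≤ Real.exp (K * b) * (Real.exp (-K * a) * g a) :=
        mul_le_mul_of_nonneg_left (hanti hab) (Real.exp_pos _).le
    _ = Real.exp (K * (b - a)) * g a := by
        rw [← mul_assoc, ← Real.exp_add]; ring_nf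

/-- Two-sided differential Grönwall inequality. -/
lemma le_exp_mul_abs_of_abs_hasDerivAt_le {g g' : ℝ → ℝ} {K : ℝ}
    (hg : ∀ x, HasDerivAt g (g' x) x) (hle : ∀ x, |g' x| ≤ K * g x) (s t : ℝ) :
    g s ≤ Real.exp (K * |t - s|) * g t := by
  rcases le_total t s with hts | hst
  · rw [abs_of_nonpos (sub_nonpos.2 hts), neg_sub]
    exact le_exp_mul_of_hasDerivAt_le hg (fun x ↦ (le_abs_self _).trans (hle x)) hts
  · have hneg (x : ℝ) : HasDerivAt (fun y ↦ g (-y)) (-g' (-x)) x := by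
      simpa [Function.comp_def] using (hg (-x)).comp x (hasDerivAt_neg x)
    have := le_exp_mul_of_hasDerivAt_le hneg (fun x ↦ (neg_le_abs _).trans (hle (-x)))
      (neg_le_neg hst)
    rw [abs_of_nonneg (sub_nonneg.2 hst)]
    simpa [neg_add_eq_sub] using this

/-- Abstract Grönwall argument behind the first bound of Lemma 3.2 of the paper:
if `f'(s) = −i(u(s) + r(s))` with `⟨f(s), u(s)⟩` real and `‖r(s)‖ ≤ C‖f(s)‖`, then
`‖f(s)‖ ≤ e^{C|t−s|} ‖f(t)‖` for all `s, t`. -/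
theorem stmt_5
    {H : Type*} [NormedAddCommGroup H] [InnerProductSpace ℂ H] [CompleteSpace H]
    (C : ℝ) (hC : 0 ≤ C)
    (f : ℝ → H)
    (h : ∀ s : ℝ, ∃ u r : H,
      HasDerivAt f ((-Complex.I) • (u + r)) s ∧
      (⟪f s, u⟫_ℂ).im = 0 ∧ ‖r‖ ≤ C * ‖f s‖) :
    ∀ s t : ℝ, ‖f s‖ ≤ Real.exp (C * |t - s|) * ‖f t‖ := by
  intro s t
  let _ : InnerProductSpace ℝ H := InnerProductSpace.rclikeToReal ℂ H
  choose u r hf hu hr using h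
  have hre (x : ℝ) : ⟪f x, (-Complex.I) • (u x + r x)⟫_ℝ = (⟪f x, r x⟫_ℂ).im := by
    rw [real_inner_eq_re_inner ℂ, inner_smul_right, inner_add_right]
    simp [hu x]
  have hsq : ‖f s‖ ^ 2 ≤ Real.exp (2 * C * |t - s|) * ‖f t‖ ^ 2 := by
    refine le_exp_mul_abs_of_abs_hasDerivAt_le (fun x ↦ (hf x).norm_sq) (fun x ↦ ?_) s t
    rw [hre, abs_mul, abs_two]
    calc 2 * |(⟪f x, r x⟫_ℂ).im| ≤ 2 * (‖f x‖ * ‖r x‖) := by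
          gcongr
          exact (Complex.abs_im_le_norm _).trans (norm_inner_le_norm _ _)
      _ ≤ 2 * (‖f x‖ * (C * ‖f x‖)) := by gcongr; exact hr x
      _ = 2 * C * ‖f x‖ ^ 2 := by ring
  refine le_of_pow_le_pow_left₀ two_ne_zero (by positivity) ?_
  rwa [mul_pow, ← Real.exp_nat_mul, Nat.cast_ofNat, ← mul_assoc 2]
end
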